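/- For every n ≥ 1, k ≥ 2 and r ≥ 1, there exists an injective group homomorphism from the higher dimensional Thompson group nV_{k,r} into nV_{2,1}. -/

import Mathlib

namespace NV

/-- The Cantor space `C_k = {0,…,k-1}^ℕ` of one-sided infinite sequences. -/
abbrev Cantor (k : ℕ) : Type := ℕ → Fin k

/-- Concatenation `u·x` of a finite word `u` with an infinite sequence `x`. -/
def concat {k : ℕ} (u : List (Fin k)) (x : Cantor k) : Cantor k :=
  fun i => if h : i < u.length then u.get ⟨i, h⟩ else x (i - u.length)

/-- The space `Y(n,k,r) = (C_k)^n × {1,…,r}`. -/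
abbrev Y (n k r : ℕ) : Type := (Fin n → Cantor k) × Fin r

/-- The box `{(u_1·x_1,…,u_n·x_n, a) : x_1,…,x_n ∈ C_k}` determined by
finite words `u_1,…,u_n` and an index `a`. -/
def box {n k r : ℕ} (u : Fin n → List (Fin k)) (a : Fin r) : Set (Y n k r) :=
  {y | ∃ x : Fin n → Cantor k, y = (fun i => concat (u i) (x i), a)}

/-- A permutation of `Y(n,k,r)` is an element of the higher dimensional Thompson
group `nV_{k,r}` if there are finitely many tuples of words and indices whose domain
boxes partition `Y(n,k,r)`, whose range boxes partition `Y(n,k,r)`, and on which `γ`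
acts by the corresponding prefix substitutions. -/
def IsElement {n k r : ℕ} (γ : Equiv.Perm (Y n k r)) : Prop :=
  ∃ (m : ℕ) (u v : Fin m → Fin n → List (Fin k)) (a b : Fin m → Fin r),
    (∀ y : Y n k r, ∃! t : Fin m, y ∈ box (u t) (a t)) ∧
    (∀ y : Y n k r, ∃! t : Fin m, y ∈ box (v t) (b t)) ∧
    (∀ (t : Fin m) (x : Fin n → Cantor k),
      γ (fun i => concat (u t i) (x i), a t) = (fun i => concat (v t i) (x i), b t))

/-- The underlying set of the higher dimensional Thompson group `nV_{k,r}`,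
as a set of permutations of `Y(n,k,r)`. -/
def thompsonSet (n k r : ℕ) : Set (Equiv.Perm (Y n k r)) := {γ | IsElement γ}

@[simp]
theorem concat_nil {k : ℕ} (x : Cantor k) : concat [] x = x := by
  funext i
  simp [concat]

theorem concat_cons_zero {k : ℕ} (a : Fin k) (u : List (Fin k)) (x : Cantor k) :
    concat (a :: u) x 0 = a := by
  simp [concat]

theorem concat_cons_succ {k : ℕ} (a : Fin k) (u : List (Fin k)) (x : Cantor k) (i : ℕ) :
    concat (a :: u) x (i + 1) = concat u x i := by
  simp [concat]

theorem concat_cons {k : ℕ} (a : Fin k) (u : List (Fin k)) (x : Cantor k) :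
    concat (a :: u) x = concat [a] (concat u x) := by
  funext i
  cases i with
  | zero => simp only [concat_cons_zero]
  | succ i => simp only [concat_cons_succ, concat_nil]

theorem concat_append {k : ℕ} (u v : List (Fin k)) (x : Cantor k) :
    concat (u ++ v) x = concat u (concat v x) := by
  induction u with
  | nil => simp
  | cons a u ih => rw [List.cons_append, concat_cons, ih, ← concat_cons]

theorem concat_singleton_eta {k : ℕ} (x : Cantor k) :
    concat [x 0] (fun i => x (i + 1)) = x := by
  funext i
  cases i with
  | zero => rw [concat_cons_zero]
  | succ i => rw [concat_cons_succ, concat_nil]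

theorem concat_singleton_inj {k : ℕ} {a b : Fin k} {x y : Cantor k}
    (h : concat [a] x = concat [b] y) : a = b ∧ x = y := by
  refine ⟨by simpa only [concat_cons_zero] using congrFun h 0, funext fun i => ?_⟩
  simpa only [concat_cons_succ, concat_nil] using congrFun h (i + 1)

/-- If `x` and `y` agree below `N`, then for a nonempty word `u` the sequences `u·x` and `u·y`
agree below `N + 1`. -/
theorem concat_agree {k : ℕ} {u : List (Fin k)} (hu : u ≠ []) {x y : Cantor k} {N : ℕ}
    (h : ∀ i < N, x i = y i) : ∀ i < N + 1, concat u x i = concat u y i := by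
  intro i hi
  have := List.length_pos_iff.mpr hu
  unfold concat
  split_ifs with h'
  · rfl
  · exact h _ (by omega)

/-- A finite family of words is a complete prefix code if every infinite sequence factors
uniquely as a member of the family followed by an infinite sequence. -/
def IsCompleteCode {k m : ℕ} (c : Fin m → List (Fin k)) : Prop :=
  Function.Bijective fun p : Fin m × Cantor k => concat (c p.1) p.2

theorem IsCompleteCode.concat_inj {k m : ℕ} {c : Fin m → List (Fin k)} (hc : IsCompleteCode c)
    {i j : Fin m} {x y : Cantor k} (h : concat (c i) x = concat (c j) y) : i = j ∧ x = y :=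
  Prod.mk.inj (hc.1 (a₁ := (i, x)) (a₂ := (j, y)) h)

theorem exists_isCompleteCode (m : ℕ) :
    ∃ c : Fin (m + 1) → List (Fin 2), IsCompleteCode c := by
  induction m with
  | zero =>
    refine ⟨fun _ => [], ?_, fun y => ⟨(0, y), concat_nil y⟩⟩
    rintro ⟨a, x⟩ ⟨b, y⟩ h
    exact Prod.ext (Subsingleton.elim (α := Fin 1) _ _) (by simpa using h)
  | succ m ih =>
    obtain ⟨c, hc⟩ := ih
    refine ⟨Fin.cons [0] fun j => 1 :: c j, ?_, fun y => ?_⟩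
    · rintro ⟨a, x⟩ ⟨b, y⟩ h
      induction a using Fin.cases <;> induction b using Fin.cases <;>
        simp only [Fin.cons_zero, Fin.cons_succ] at h
      · rw [(concat_singleton_inj h).2]
      · rw [concat_cons 1] at h
        exact absurd (concat_singleton_inj h).1 (by decide)
      · rw [concat_cons 1] at h
        exact absurd (concat_singleton_inj h).1 (by decide)
      · rw [concat_cons 1, concat_cons 1 (c _) y] at h
        obtain ⟨rfl, rfl⟩ := hc.concat_inj (concat_singleton_inj h).2
        rfl
    · have hy := concat_singleton_eta y
      obtain h | h : y 0 = 0 ∨ y 0 = 1 := by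
        generalize y 0 = b
        revert b
        decide
      · exact ⟨(0, fun i => y (i + 1)), by rw [← h]; exact hy⟩
      · obtain ⟨⟨j, z⟩, hz⟩ := hc.2 fun i => y (i + 1)
        refine ⟨(j.succ, z), ?_⟩
        simp only [Fin.cons_succ] at hz ⊢
        rw [concat_cons, hz, ← h, hy]

theorem IsCompleteCode.ne_nil {k m : ℕ} (hk : 0 < k) (hm : 2 ≤ m) {c : Fin m → List (Fin k)}
    (hc : IsCompleteCode c) (j : Fin m) : c j ≠ [] := by
  intro hj
  have : Nontrivial (Fin m) := Fin.nontrivial_iff_two_le.mpr hm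
  obtain ⟨l, hl⟩ := exists_ne j
  have h : concat (c j) (concat (c l) fun _ => ⟨0, hk⟩) = concat (c l) fun _ => ⟨0, hk⟩ := by
    rw [hj, concat_nil]
  exact hl (hc.concat_inj h).1.symm

/-- The `N`-th approximation `c(x_0)⋯c(x_{N-1})·000…` of the infinite concatenation of the words
`c(x_i)`. -/
def encodeApprox {k : ℕ} (c : Fin k → List (Fin 2)) : ℕ → Cantor k → Cantor 2
  | 0, _ => fun _ => 0
  | N + 1, x => concat (c (x 0)) (encodeApprox c N fun i => x (i + 1))

/-- The infinite concatenation `c(x_0)c(x_1)⋯`. -/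
def encode {k : ℕ} (c : Fin k → List (Fin 2)) (x : Cantor k) : Cantor 2 :=
  fun i => encodeApprox c (i + 1) x i

section encode

variable {k : ℕ} {c : Fin k → List (Fin 2)}

theorem encodeApprox_agree (hc : ∀ j, c j ≠ []) (N : ℕ) :
    ∀ (M : ℕ) (x : Cantor k), N ≤ M → ∀ i < N, encodeApprox c N x i = encodeApprox c M x i := by
  induction N with
  | zero => intro M x _ i hi; omega
  | succ N ih =>
    intro M x hM
    obtain ⟨M, rfl⟩ : ∃ M', M = M' + 1 := ⟨M - 1, by omega⟩
    exact concat_agree (hc _) (ih M _ (by omega))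

theorem encode_eq_concat (hc : ∀ j, c j ≠ []) (x : Cantor k) :
    encode c x = concat (c (x 0)) (encode c fun i => x (i + 1)) := by
  funext i
  exact concat_agree (hc _)
    (fun j hj => (encodeApprox_agree hc (j + 1) i _ hj j (Nat.lt_succ_self j)).symm) i
    (Nat.lt_succ_self i)

theorem encode_concat (hc : ∀ j, c j ≠ []) (u : List (Fin k)) (x : Cantor k) :
    encode c (concat u x) = concat (u.flatMap c) (encode c x) := by
  induction u with
  | nil => simp
  | cons a u ih =>
    rw [encode_eq_concat hc, concat_cons_zero, List.flatMap_cons, concat_append, ← ih]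
    simp only [concat_cons_succ]

theorem encode_injective (hc : ∀ j, c j ≠ []) (hcode : IsCompleteCode c) :
    Function.Injective (encode c) := by
  have key : ∀ (i : ℕ) (x y : Cantor k), encode c x = encode c y → x i = y i := by
    intro i
    induction i with
    | zero =>
      intro x y h
      rw [encode_eq_concat hc, encode_eq_concat hc y] at h
      exact (hcode.concat_inj h).1
    | succ i ih =>
      intro x y h
      rw [encode_eq_concat hc, encode_eq_concat hc y] at h
      exact ih _ _ (hcode.concat_inj h).2
  exact fun x y h => funext fun i => key i x y h

theorem encode_surjective (hc : ∀ j, c j ≠ []) (hcode : IsCompleteCode c) :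
    Function.Surjective (encode c) := by
  choose g hg using hcode.2
  let T : Cantor 2 → Cantor 2 := fun y => (g y).2
  let τ : Cantor 2 → Cantor k := fun y i => (g (T^[i] y)).1
  have key : ∀ (N : ℕ) (y : Cantor 2), ∀ i < N, encode c (τ y) i = y i := by
    intro N
    induction N with
    | zero => intro y i hi; omega
    | succ N ih =>
      intro y i hi
      rw [encode_eq_concat hc]
      conv_rhs => rw [← hg y]
      exact concat_agree (hc _) (ih (T y)) i hi
  exact fun y => ⟨τ y, funext fun i => key (i + 1) y i (Nat.lt_succ_self i)⟩

end encode

/-- A bijection which carries every canonical box onto a canonical box, compatibly with prefix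
substitution, conjugates Thompson group elements to Thompson group elements. -/
theorem IsElement.permCongr {n k r k' r' : ℕ} {γ : Equiv.Perm (Y n k r)} (hγ : IsElement γ)
    (φ : Y n k r ≃ Y n k' r') (σ : (Fin n → Cantor k) → (Fin n → Cantor k'))
    (hσ : Function.Surjective σ)
    (W : (Fin n → List (Fin k)) → Fin r → Fin n → List (Fin k')) (B : Fin r → Fin r')
    (hφ : ∀ u a x, φ (fun i => concat (u i) (x i), a) =
      (fun i => concat (W u a i) (σ x i), B a)) :
    IsElement (φ.permCongr γ) := by
  have hbox : ∀ (u : Fin n → List (Fin k)) (a : Fin r) (y : Y n k' r'),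
      y ∈ box (W u a) (B a) ↔ φ.symm y ∈ box u a := by
    intro u a y
    constructor
    · rintro ⟨x, rfl⟩
      obtain ⟨x, rfl⟩ := hσ x
      exact ⟨x, by rw [← hφ, Equiv.symm_apply_apply]⟩
    · rintro ⟨x, hx⟩
      exact ⟨σ x, by rw [← hφ, ← hx, Equiv.apply_symm_apply]⟩
  obtain ⟨m, u, v, a, b, hu, hv, h⟩ := hγ
  refine ⟨m, fun t => W (u t) (a t), fun t => W (v t) (b t), fun t => B (a t), fun t => B (b t),
    fun y => ?_, fun y => ?_, fun t x => ?_⟩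
  · simpa only [hbox] using hu (φ.symm y)
  · simpa only [hbox] using hv (φ.symm y)
  · obtain ⟨x, rfl⟩ := hσ x
    rw [← hφ, ← hφ, ← h, Equiv.permCongr_apply, Equiv.symm_apply_apply]

/-- There is a bijection `Y(n,k,r) ≃ Y(n,2,1)` conjugating `nV_{k,r}` into `nV_{2,1}`. -/
theorem exists_equiv_isElement_permCongr {n k r : ℕ} (hn : 1 ≤ n) (hk : 2 ≤ k) (hr : 1 ≤ r) :
    ∃ φ : Y n k r ≃ Y n 2 1, ∀ γ, IsElement γ → IsElement (φ.permCongr γ) := by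
  obtain ⟨c, hcode⟩ : ∃ c : Fin k → List (Fin 2), IsCompleteCode c := by
    obtain ⟨k, rfl⟩ : ∃ k', k = k' + 1 := ⟨k - 1, by omega⟩
    exact exists_isCompleteCode k
  obtain ⟨d, hd⟩ : ∃ d : Fin r → List (Fin 2), IsCompleteCode d := by
    obtain ⟨r, rfl⟩ : ∃ r', r = r' + 1 := ⟨r - 1, by omega⟩
    exact exists_isCompleteCode r
  have hc := hcode.ne_nil two_pos hk
  have hinj := encode_injective hc hcode
  have hsurj := encode_surjective hc hcode
  let i₀ : Fin n := ⟨0, hn⟩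
  let e : Fin n → Fin r → List (Fin 2) := fun i a => if i = i₀ then d a else []
  have he₀ : ∀ a, e i₀ a = d a := fun a => if_pos rfl
  have he : ∀ i a, i ≠ i₀ → e i a = [] := fun i a hi => if_neg hi
  let F : Y n k r → Y n 2 1 := fun y => (fun i => concat (e i y.2) (encode c (y.1 i)), 0)
  have hF : Function.Bijective F := by
    constructor
    · rintro ⟨x, a⟩ ⟨y, b⟩ h
      have h' : ∀ i, concat (e i a) (encode c (x i)) = concat (e i b) (encode c (y i)) :=
        congrFun (congrArg Prod.fst h)
      have h₀ := h' i₀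
      rw [he₀, he₀] at h₀
      obtain ⟨hab, hxy⟩ := hd.concat_inj h₀
      refine Prod.ext (funext fun i => ?_) hab
      by_cases hi : i = i₀
      · rw [hi]
        exact hinj hxy
      · have := h' i
        rw [he i a hi, he i b hi, concat_nil, concat_nil] at this
        exact hinj this
    · rintro ⟨y, s⟩
      obtain ⟨⟨a, z⟩, hz⟩ := hd.2 (y i₀)
      choose g hg using hsurj
      refine ⟨(fun i => if i = i₀ then g z else g (y i), a),
        Prod.ext (funext fun i => ?_) (Subsingleton.elim _ _)⟩
      by_cases hi : i = i₀
      · subst hi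
        simpa only [F, he₀, if_true, hg] using hz
      · simp only [F, he i a hi, if_neg hi, hg, concat_nil]
  refine ⟨Equiv.ofBijective F hF, fun γ hγ => hγ.permCongr _ (fun x i => encode c (x i))
    (fun y => ?_) (fun u a i => e i a ++ (u i).flatMap c) (fun _ => 0) fun u a x => ?_⟩
  · choose g hg using hsurj
    exact ⟨fun i => g (y i), funext fun i => hg _⟩
  · simp only [Equiv.ofBijective_apply, F, encode_concat hc, concat_append]

end NV

theorem statement7 (n k r : ℕ) (hn : 1 ≤ n) (hk : 2 ≤ k) (hr : 1 ≤ r)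
    (G : Subgroup (Equiv.Perm (NV.Y n k r)))
    (hG : (G : Set (Equiv.Perm (NV.Y n k r))) = NV.thompsonSet n k r)
    (G₂ : Subgroup (Equiv.Perm (NV.Y n 2 1)))
    (hG₂ : (G₂ : Set (Equiv.Perm (NV.Y n 2 1))) = NV.thompsonSet n 2 1) :
    ∃ f : ↥G →* ↥G₂, Function.Injective f := by
  obtain ⟨φ, hφ⟩ := NV.exists_equiv_isElement_permCongr hn hk hr
  have hmem : ∀ γ : G, φ.permCongr (γ : Equiv.Perm (NV.Y n k r)) ∈ G₂ := fun γ =>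
    hG₂.symm.subset (hφ γ (hG.subset γ.2))
  refine ⟨(φ.permCongrHom.toMonoidHom.comp G.subtype).codRestrict G₂ hmem, fun γ δ h => ?_⟩
  exact Subtype.ext (φ.permCongr.injective (congrArg Subtype.val h))
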